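/- Under hypotheses (H0)-(H4), for every nonzero vector q ∈ ℝ^{d−1}×[0,∞): inf_{γ∈ℝ^{d−1}×{0}} [ sup_{a∈D∩D₀} a·γ + sup_{a∈D} a·(q−γ) ] = sup_{a∈(Θ×ℝ)∩D} a·q; in other words, the quasi-potential satisfies I(0,q) = inf_{γ∈ℝ^{d−1}×{0}} (I(0,γ) + I⁺(γ,q)) = sup_{a∈D̂} a·q. -/

import Mathlib

open scoped ENNReal
open Filter MeasureTheory

namespace ReflectedRW

/-- `ℤ^d` realized as `ℤ^{d-1} × ℤ`. -/
abbrev Zd (d : ℕ) := (Fin (d-1) → ℤ) × ℤ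
/-- `ℝ^d` realized as `ℝ^{d-1} × ℝ`. -/
abbrev Rd (d : ℕ) := (Fin (d-1) → ℝ) × ℝ
/-- The state space `ℤ^{d-1} × ℕ` of the reflected walk. -/
abbrev St (d : ℕ) := (Fin (d-1) → ℤ) × ℕ

/-- Embedding of the state space into `ℤ^d`. -/
def toZ (d : ℕ) (z : St d) : Zd d := (z.1, (z.2 : ℤ))

/-- Embedding of `ℤ^d` into `ℝ^d`. -/
def toR (d : ℕ) (z : Zd d) : Rd d := (fun i => (z.1 i : ℝ), (z.2 : ℝ))

/-- Scalar product `a · z` of `a ∈ ℝ^d` and `z ∈ ℤ^d`. -/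
noncomputable def dotZ (d : ℕ) (a : Rd d) (z : Zd d) : ℝ :=
  (∑ i, a.1 i * (z.1 i : ℝ)) + a.2 * (z.2 : ℝ)

/-- Scalar product on `ℝ^d`. -/
noncomputable def dotR (d : ℕ) (a q : Rd d) : ℝ :=
  (∑ i, a.1 i * q.1 i) + a.2 * q.2

/-- One-step transition probabilities of the reflected random walk `Z(t)`:
jumps with law `μ` in the interior and with law `μ0` on the boundary `y = 0`. -/
noncomputable def step (d : ℕ) (μ μ0 : Zd d → ℝ) (z z' : St d) : ℝ≥0∞ :=
  if z.2 = 0 then ENNReal.ofReal (μ0 (toZ d z' - toZ d z))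
  else ENNReal.ofReal (μ (toZ d z' - toZ d z))

/-- Real-valued version of the transition kernel of `Z(t)`. -/
noncomputable def stepR (d : ℕ) (μ μ0 : Zd d → ℝ) (z z' : St d) : ℝ :=
  if z.2 = 0 then μ0 (toZ d z' - toZ d z) else μ (toZ d z' - toZ d z)

/-- `n`-step kernel obtained by iterating a sub-Markov kernel `p`. -/
noncomputable def kerIter {S : Type*} [DecidableEq S] (p : S → S → ℝ≥0∞) :
    ℕ → S → S → ℝ≥0∞
  | 0, z, z' => if z = z' then 1 else 0
  | n+1, z, z' => ∑' w : S, kerIter p n z w * p w z'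

/-- `n`-step transition probabilities of `Z(t)`: `P_z(Z(n) = z')`. -/
noncomputable def stepn (d : ℕ) (μ μ0 : Zd d → ℝ) : ℕ → St d → St d → ℝ≥0∞ :=
  kerIter (step d μ μ0)

/-- Green's function `G(z,z') = ∑_{t ≥ 0} P_z(Z(t) = z')` of the reflected walk. -/
noncomputable def green (d : ℕ) (μ μ0 : Zd d → ℝ) (z z' : St d) : ℝ≥0∞ :=
  ∑' n : ℕ, stepn d μ μ0 n z z'

/-- Kernel of the walk killed upon hitting the boundary hyperplane `y = 0`. -/
noncomputable def stepKilled (d : ℕ) (μ μ0 : Zd d → ℝ) (z z' : St d) : ℝ≥0∞ :=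
  if z'.2 = 0 then 0 else step d μ μ0 z z'

/-- `n`-step kernel of the killed walk: `P_z(Z(n) = z', τ > n)` where
`τ` is the first return time to the boundary hyperplane. -/
noncomputable def stepKilledn (d : ℕ) (μ μ0 : Zd d → ℝ) : ℕ → St d → St d → ℝ≥0∞ :=
  kerIter (stepKilled d μ μ0)

/-- Green's function `G₊(z,z')` of the killed walk. -/
noncomputable def greenPlus (d : ℕ) (μ μ0 : Zd d → ℝ) (z z' : St d) : ℝ≥0∞ :=
  ∑' n : ℕ, stepKilledn d μ μ0 n z z'

/-- One-step kernel of the homogeneous random walk `S(t)` on `ℤ^d`. -/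
noncomputable def stepS (d : ℕ) (μ : Zd d → ℝ) (z z' : Zd d) : ℝ≥0∞ :=
  ENNReal.ofReal (μ (z' - z))

/-- `n`-step kernel of the homogeneous random walk on `ℤ^d`. -/
noncomputable def stepSn (d : ℕ) (μ : Zd d → ℝ) : ℕ → Zd d → Zd d → ℝ≥0∞ :=
  kerIter (stepS d μ)

/-- Green's function `G_S` of the homogeneous random walk on `ℤ^d`. -/
noncomputable def greenS (d : ℕ) (μ : Zd d → ℝ) (z z' : Zd d) : ℝ≥0∞ :=
  ∑' n : ℕ, stepSn d μ n z z'

/-- `hitProb z w = P_z(τ < ∞, Z(τ) = w)`, the hitting distribution on the boundary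
hyperplane, `τ = inf{t ≥ 1 : Z(t) ∈ ℤ^{d-1}×{0}}`. -/
noncomputable def hitProb (d : ℕ) (μ μ0 : Zd d → ℝ) (z w : St d) : ℝ≥0∞ :=
  if w.2 = 0 then
    ∑' n : ℕ, ∑' v : St d, stepKilledn d μ μ0 n z v * step d μ μ0 v w
  else 0

/-- The jump generating function `φ(a) = ∑_z μ(z) e^{a·z}`. -/
noncomputable def jgf (d : ℕ) (μ : Zd d → ℝ) (a : Rd d) : ℝ :=
  ∑' z : Zd d, μ z * Real.exp (dotZ d a z)

/-- Partial derivative `∂φ/∂β` of the jump generating function in the last coordinate. -/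
noncomputable def jgfDβ (d : ℕ) (μ : Zd d → ℝ) (a : Rd d) : ℝ :=
  ∑' z : Zd d, μ z * (z.2 : ℝ) * Real.exp (dotZ d a z)

/-- Gradient `∇φ(a)` of the jump generating function. -/
noncomputable def jgfGrad (d : ℕ) (μ : Zd d → ℝ) (a : Rd d) : Rd d :=
  (fun i => ∑' z : Zd d, μ z * (z.1 i : ℝ) * Real.exp (dotZ d a z), jgfDβ d μ a)

/-- The set `D = {a : φ(a) ≤ 1}`. -/
def Dset (d : ℕ) (μ : Zd d → ℝ) : Set (Rd d) := {a | jgf d μ a ≤ 1}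

/-- `∂₊D`: points of the boundary of `D` where the last coordinate of `∇φ` is `≥ 0`. -/
def bdPlus (d : ℕ) (μ : Zd d → ℝ) : Set (Rd d) :=
  {a | jgf d μ a = 1 ∧ 0 ≤ jgfDβ d μ a}

/-- `∂₋D`: points of the boundary of `D` where the last coordinate of `∇φ` is `≤ 0`. -/
def bdMinus (d : ℕ) (μ : Zd d → ℝ) : Set (Rd d) :=
  {a | jgf d μ a = 1 ∧ jgfDβ d μ a ≤ 0}

/-- `∂₀D`: points of the boundary of `D` where the last coordinate of `∇φ` is `0`. -/
def bdZero (d : ℕ) (μ : Zd d → ℝ) : Set (Rd d) :=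
  {a | jgf d μ a = 1 ∧ jgfDβ d μ a = 0}

/-- `Θ = {α ∈ ℝ^{d-1} : inf_β max(φ(α,β), φ₀(α,β)) ≤ 1}`. -/
noncomputable def Theta (d : ℕ) (μ μ0 : Zd d → ℝ) : Set (Fin (d-1) → ℝ) :=
  {α | (⨅ β : ℝ, max (jgf d μ (α, β)) (jgf d μ0 (α, β))) ≤ 1}

/-- `D̂ = (Θ×ℝ) ∩ D`. -/
noncomputable def Dhat (d : ℕ) (μ μ0 : Zd d → ℝ) : Set (Rd d) :=
  {a | a.1 ∈ Theta d μ μ0 ∧ jgf d μ a ≤ 1}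

/-- Normal cone to a convex set `s ⊆ ℝ^d` at the point `a`. -/
noncomputable def normalCone (d : ℕ) (s : Set (Rd d)) (a : Rd d) : Set (Rd d) :=
  {q | ∀ b ∈ s, dotR d q (b - a) ≤ 0}

/-- The mean vector `m = ∑_z z μ(z)`. -/
noncomputable def meanVec (d : ℕ) (μ : Zd d → ℝ) : Rd d :=
  (fun i => ∑' z : Zd d, μ z * (z.1 i : ℝ), ∑' z : Zd d, μ z * (z.2 : ℝ))

/-- The harmonic functions `h_a` of (1-8), for `a ∈ D̂ ∩ ∂₊D` with associated
point `abar = ā ∈ ∂₋D` (same first `d-1` coordinates as `a`). -/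
noncomputable def hfun (d : ℕ) (μ μ0 : Zd d → ℝ) (a abar : Rd d) (z : St d) : ℝ :=
  if jgf d μ0 abar = 1 then Real.exp (dotZ d abar (toZ d z))
  else if a = abar then
    (z.2 : ℝ) * Real.exp (dotZ d a (toZ d z))
      + (jgfDβ d μ0 a / (1 - jgf d μ0 a)) * Real.exp (dotZ d a (toZ d z))
  else
    Real.exp (dotZ d a (toZ d z))
      - ((1 - jgf d μ0 a) / (1 - jgf d μ0 abar)) * Real.exp (dotZ d abar (toZ d z))

/-- `h : ℤ^{d-1}×ℕ → ℝ` is harmonic for the reflected walk. -/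
def IsHarmonic (d : ℕ) (μ μ0 : Zd d → ℝ) (h : St d → ℝ) : Prop :=
  ∀ z : St d, HasSum (fun z' => stepR d μ μ0 z z' * h z') (h z)

/-- Minimal nonnegative harmonic function. -/
def IsMinimalHarmonic (d : ℕ) (μ μ0 : Zd d → ℝ) (h : St d → ℝ) : Prop :=
  IsHarmonic d μ μ0 h ∧ (∀ z, 0 ≤ h z) ∧ h ≠ 0 ∧
    ∀ h' : St d → ℝ, IsHarmonic d μ μ0 h' → (∀ z, 0 ≤ h' z) → h' ≠ 0 →
      (∀ z, h' z ≤ h z) → ∃ c : ℝ, 0 < c ∧ h' = fun z => c * h z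

/- Hypotheses (H0)–(H4). -/

/-- `(H0)`: `μ(x,y) = 0` for `y < -1` and `μ₀(x,y) = 0` for `y < 0`. -/
def H0 (d : ℕ) (μ μ0 : Zd d → ℝ) : Prop :=
  (∀ z : Zd d, z.2 < -1 → μ z = 0) ∧ (∀ z : Zd d, z.2 < 0 → μ0 z = 0)

/-- `(H1)`: the reflected walk is irreducible on `ℤ^{d-1}×ℕ`. -/
def H1 (d : ℕ) (μ μ0 : Zd d → ℝ) : Prop :=
  ∀ z z' : St d, ∃ n : ℕ, 0 < stepn d μ μ0 n z z'

/-- `(H2)`: the homogeneous walk with step law `μ` is irreducible on `ℤ^d` and its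
last coordinate is an aperiodic random walk on `ℤ`. -/
def H2 (d : ℕ) (μ : Zd d → ℝ) : Prop :=
  (∀ z z' : Zd d, ∃ n : ℕ, 0 < stepSn d μ n z z') ∧
    AddSubgroup.closure {y : ℤ | ∃ x : Fin (d-1) → ℤ, μ (x, y) ≠ 0} = ⊤

/-- `(H3)`: `m ≠ 0` and `m/|m| + m₀/|m₀| ≠ 0`. -/
noncomputable def H3 (d : ℕ) (μ μ0 : Zd d → ℝ) : Prop :=
  meanVec d μ ≠ 0 ∧ meanVec d μ0 ≠ 0 ∧
    ‖meanVec d μ‖⁻¹ • meanVec d μ + ‖meanVec d μ0‖⁻¹ • meanVec d μ0 ≠ 0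

/-- `(H4)`: the jump generating functions are finite everywhere on `ℝ^d`. -/
def H4 (d : ℕ) (μ μ0 : Zd d → ℝ) : Prop :=
  ∀ a : Rd d, Summable (fun z : Zd d => μ z * Real.exp (dotZ d a z)) ∧
    Summable (fun z : Zd d => μ0 z * Real.exp (dotZ d a z))

/-- `μ` is a probability distribution on `ℤ^d`. -/
def IsProb (d : ℕ) (μ : Zd d → ℝ) : Prop :=
  (∀ z : Zd d, 0 ≤ μ z) ∧ HasSum μ 1


theorem dotR_add_left (d : ℕ) (a b q : Rd d) : dotR d (a + b) q = dotR d a q + dotR d b q := by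
  simp [dotR, add_mul, Finset.sum_add_distrib]; ring

theorem dotR_smul_left (d : ℕ) (r : ℝ) (a q : Rd d) : dotR d (r • a) q = r * dotR d a q := by
  simp [dotR, mul_add, Finset.mul_sum, mul_assoc]

theorem dotR_sub_right (d : ℕ) (a q r : Rd d) : dotR d a (q - r) = dotR d a q - dotR d a r := by
  simp [dotR, mul_sub, Finset.sum_sub_distrib]; ring

theorem continuous_dotR (d : ℕ) (q : Rd d) : Continuous fun a => dotR d a q := by
  unfold dotR; fun_prop

theorem dotZ_eq_dotR (d : ℕ) (a : Rd d) (z : Zd d) : dotZ d a z = dotR d a (toR d z) := rfl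

theorem dotZ_add_right (d : ℕ) (a : Rd d) (z w : Zd d) :
    dotZ d a (z + w) = dotZ d a z + dotZ d a w := by
  simp [dotZ, mul_add, Finset.sum_add_distrib]; ring

theorem jgf_nonneg (d : ℕ) (μ : Zd d → ℝ) (hμ : ∀ z, 0 ≤ μ z) (a : Rd d) : 0 ≤ jgf d μ a :=
  tsum_nonneg fun z => mul_nonneg (hμ z) (Real.exp_pos _).le

theorem jgf_zero (d : ℕ) (μ : Zd d → ℝ) (hμ : HasSum μ 1) : jgf d μ 0 = 1 := by
  simpa [jgf, dotZ] using hμ.tsum_eq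

theorem jgf_le_iff (d : ℕ) (μ : Zd d → ℝ) (hμ : ∀ z, 0 ≤ μ z)
    (hs : ∀ a, Summable fun z => μ z * Real.exp (dotZ d a z)) (a : Rd d) (c : ℝ) :
    jgf d μ a ≤ c ↔ ∀ s : Finset (Zd d), ∑ z ∈ s, μ z * Real.exp (dotZ d a z) ≤ c :=
  ⟨fun h s => ((hs a).sum_le_tsum s
      fun z _ => mul_nonneg (hμ z) (Real.exp_pos _).le).trans h,
    fun h => (hs a).tsum_le_of_sum_le h⟩

theorem lowerSemicontinuous_jgf (d : ℕ) (μ : Zd d → ℝ) (hμ : ∀ z, 0 ≤ μ z)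
    (hs : ∀ a, Summable fun z => μ z * Real.exp (dotZ d a z)) :
    LowerSemicontinuous (jgf d μ) := by
  rw [lowerSemicontinuous_iff_isClosed_preimage]
  intro c
  have : jgf d μ ⁻¹' Set.Iic c =
      ⋂ s : Finset (Zd d), {a | ∑ z ∈ s, μ z * Real.exp (dotZ d a z) ≤ c} := by
    ext a
    simpa using jgf_le_iff d μ hμ hs a c
  rw [this]
  refine isClosed_iInter fun s => isClosed_le ?_ continuous_const
  simp only [dotZ]
  fun_prop

theorem convexOn_jgf (d : ℕ) (μ : Zd d → ℝ) (hμ : ∀ z, 0 ≤ μ z)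
    (hs : ∀ a, Summable fun z => μ z * Real.exp (dotZ d a z)) :
    ConvexOn ℝ Set.univ (jgf d μ) := by
  refine ⟨convex_univ, fun a _ b _ r s hr hs' hrs => ?_⟩
  simp only [jgf, smul_eq_mul]
  rw [← tsum_mul_left, ← tsum_mul_left, ← ((hs a).mul_left r).tsum_add ((hs b).mul_left s)]
  refine (hs _).tsum_le_tsum (fun z => ?_) (((hs a).mul_left r).add ((hs b).mul_left s))
  have h := convexOn_exp.2 (Set.mem_univ (dotZ d a z)) (Set.mem_univ (dotZ d b z)) hr hs' hrs
  simp only [smul_eq_mul] at h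
  rw [dotZ_eq_dotR, dotR_add_left, dotR_smul_left, dotR_smul_left, ← dotZ_eq_dotR,
    ← dotZ_eq_dotR]
  nlinarith [mul_le_mul_of_nonneg_left h (hμ z)]

theorem exists_dotZ_le_of_stepSn_pos (d : ℕ) (μ : Zd d → ℝ) (hμ : ∀ z, 0 ≤ μ z)
    (hs : ∀ a, Summable fun z => μ z * Real.exp (dotZ d a z)) (c : ℝ) (n : ℕ) (z : Zd d)
    (h : 0 < stepSn d μ n 0 z) : ∃ K, ∀ a, jgf d μ a ≤ c → dotZ d a z ≤ K := by
  induction n generalizing z with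
  | zero =>
    simp only [stepSn, kerIter] at h
    split_ifs at h with hz
    · subst hz
      exact ⟨0, fun a _ => by simp [dotZ]⟩
    · simp at h
  | succ n ih =>
    have h' : (∑' w, stepSn d μ n 0 w * stepS d μ w z) ≠ 0 := h.ne'
    obtain ⟨w, hw⟩ : ∃ w, stepSn d μ n 0 w * stepS d μ w z ≠ 0 := by
      by_contra! hcon
      exact h' (by simp [hcon])
    obtain ⟨hw1, hw2⟩ := mul_ne_zero_iff.1 hw
    obtain ⟨K, hK⟩ := ih w (pos_iff_ne_zero.2 hw1)
    have hpos : 0 < μ (z - w) := ENNReal.ofReal_pos.1 (pos_iff_ne_zero.2 hw2)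
    refine ⟨K + c / μ (z - w), fun a ha => ?_⟩
    have h1 : μ (z - w) * Real.exp (dotZ d a (z - w)) ≤ c := by
      simpa using (jgf_le_iff d μ hμ hs a c).1 ha {z - w}
    have h2 : dotZ d a (z - w) ≤ c / μ (z - w) := by
      rw [le_div_iff₀ hpos, mul_comm]
      refine le_trans (mul_le_mul_of_nonneg_left ?_ hpos.le) h1
      linarith [Real.add_one_le_exp (dotZ d a (z - w))]
    have h3 : dotZ d a z = dotZ d a w + dotZ d a (z - w) := by
      rw [← dotZ_add_right, add_sub_cancel]
    linarith [hK a ha]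

theorem isCompact_jgf_le (d : ℕ) (μ : Zd d → ℝ) (hμ : ∀ z, 0 ≤ μ z)
    (hs : ∀ a, Summable fun z => μ z * Real.exp (dotZ d a z))
    (hirr : ∀ z z' : Zd d, ∃ n : ℕ, 0 < stepSn d μ n z z') (c : ℝ) :
    IsCompact {a | jgf d μ a ≤ c} := by
  have hbd : ∀ z : Zd d, ∃ K, ∀ a, jgf d μ a ≤ c → dotZ d a z ≤ K := fun z =>
    let ⟨n, hn⟩ := hirr 0 z
    exists_dotZ_le_of_stepSn_pos d μ hμ hs c n z hn
  choose K hK using hbd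
  have hclosed : IsClosed {a | jgf d μ a ≤ c} :=
    (lowerSemicontinuous_jgf d μ hμ hs).isClosed_preimage c
  refine (isCompact_Icc (a := ((fun i => -K (Pi.single i (-1), 0), -K (0, -1)) : Rd d))
    (b := (fun i => K (Pi.single i 1, 0), K (0, 1)))).of_isClosed_subset hclosed ?_
  intro a ha
  refine ⟨⟨fun i => ?_, ?_⟩, fun i => ?_, ?_⟩
  · have := hK (Pi.single i (-1), 0) a ha
    simp [dotZ, Pi.single_apply] at this
    simp only; linarith
  · have := hK (0, -1) a ha
    simp [dotZ] at this
    simp only; linarith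
  · simpa [dotZ, Pi.single_apply] using hK (Pi.single i 1, 0) a ha
  · simpa [dotZ] using hK (0, 1) a ha

theorem mem_Theta_iff (d : ℕ) (μ μ0 : Zd d → ℝ) (hμ : ∀ z, 0 ≤ μ z) (hμ0 : ∀ z, 0 ≤ μ0 z)
    (hs : ∀ a, Summable fun z => μ z * Real.exp (dotZ d a z))
    (hs0 : ∀ a, Summable fun z => μ0 z * Real.exp (dotZ d a z))
    (hirr : ∀ z z' : Zd d, ∃ n : ℕ, 0 < stepSn d μ n z z') (α : Fin (d-1) → ℝ) :
    α ∈ Theta d μ μ0 ↔ ∃ β : ℝ, (α, β) ∈ Dset d μ ∩ Dset d μ0 := by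
  set f : ℝ → ℝ := fun β => max (jgf d μ (α, β)) (jgf d μ0 (α, β)) with hf
  constructor
  · intro h
    have hinf : (⨅ β, f β) ≤ 1 := h
    have hcont : Continuous fun β : ℝ => ((α, β) : Rd d) := by fun_prop
    have hlsc : LowerSemicontinuous f :=
      ((lowerSemicontinuous_jgf d μ hμ hs).comp hcont).sup
        ((lowerSemicontinuous_jgf d μ0 hμ0 hs0).comp hcont)
    have hcompact : IsCompact {β | f β ≤ 2} := by
      refine ((isCompact_jgf_le d μ hμ hs hirr 2).image continuous_snd).of_isClosed_subset
        (hlsc.isClosed_preimage 2) fun β hβ => ⟨(α, β), ?_, rfl⟩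
      exact (le_max_left (jgf d μ (α, β)) (jgf d μ0 (α, β))).trans hβ
    obtain ⟨β₁, hβ₁⟩ := exists_lt_of_ciInf_lt (hinf.trans_lt one_lt_two)
    obtain ⟨β, -, hmin⟩ :=
      (hlsc.lowerSemicontinuousOn _).exists_isMinOn ⟨β₁, hβ₁.le⟩ hcompact
    have hβ : f β ≤ 1 := by
      refine le_trans (le_ciInf fun β' => ?_) hinf
      by_cases h' : f β' ≤ 2
      · exact hmin h'
      · exact ((hmin hβ₁.le).trans hβ₁.le).trans (not_le.1 h').le
    exact ⟨β, (le_max_left _ _).trans hβ, (le_max_right _ _).trans hβ⟩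
  · rintro ⟨β, h1, h2⟩
    refine (ciInf_le (f := f) ⟨0, ?_⟩ β).trans (max_le h1 h2)
    rintro _ ⟨β', rfl⟩
    exact (jgf_nonneg d μ hμ _).trans (le_max_left _ _)

/-- A continuous linear functional on `ℝ^d` is a scalar product. -/
theorem exists_dotR_eq (d : ℕ) (f : Rd d →L[ℝ] ℝ) : ∃ p : Rd d, ∀ a, f a = dotR d a p := by
  refine ⟨(fun i => f (Pi.single i 1, 0), f (0, 1)), fun a => ?_⟩
  have ha : a = (∑ i, a.1 i • ((Pi.single i 1, 0) : Rd d)) + a.2 • ((0, 1) : Rd d) := by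
    ext i <;> simp [Prod.fst_sum, Prod.snd_sum, Finset.sum_apply, Pi.single_apply]
  conv_lhs => rw [ha]
  simp only [map_add, map_sum, map_smul, smul_eq_mul, dotR]

theorem bddAbove_range_dotR (d : ℕ) {s : Set (Rd d)} (hs : IsCompact s) (q : Rd d) :
    BddAbove (Set.range fun a : s => dotR d (a : Rd d) q) := by
  have := (hs.image (continuous_dotR d q)).bddAbove
  rwa [Set.image_eq_range] at this

/-- If every point of the compact convex set `D` lying over the projection of the compact convex
set `E` satisfies `a · q < c`, then some horizontal `γ` separates the two sets at level `c`. -/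
theorem exists_horizontal_dotR_add_lt (d : ℕ) {E D : Set (Rd d)} (hE : IsCompact E)
    (hD : IsCompact D) (hEc : Convex ℝ E) (hDc : Convex ℝ D) (hE0 : 0 ∈ E) (hD0 : 0 ∈ D)
    (q : Rd d) (c : ℝ) (h : ∀ e ∈ E, ∀ b ∈ D, e.1 = b.1 → dotR d b q < c) :
    ∃ γ : Rd d, γ.2 = 0 ∧ ∀ e ∈ E, ∀ b ∈ D, dotR d e γ + dotR d b (q - γ) < c := by
  let T : Rd d × Rd d →ₗ[ℝ] Rd d :=
    { toFun := fun p => (p.1.1 - p.2.1, dotR d p.2 q)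
      map_add' := fun p p' => by
        ext <;> simp [dotR_add_left]; ring
      map_smul' := fun r p => by
        ext <;> simp [dotR_smul_left, mul_sub] }
  have hTc : Continuous T := T.continuous_of_finiteDimensional
  have hdisj : Disjoint (T '' (E ×ˢ D)) ({0} ×ˢ Set.Ici c : Set (Rd d)) := by
    rw [Set.disjoint_left]
    rintro _ ⟨⟨e, b⟩, ⟨he, hb⟩, rfl⟩ ⟨h1, h2⟩
    exact (h e he b hb (sub_eq_zero.1 h1)).not_ge h2
  obtain ⟨f, u, v, hu, huv, hv⟩ := geometric_hahn_banach_compact_closed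
    ((hEc.prod hDc).linear_image T) ((hE.prod hD).image hTc)
    ((convex_singleton (0 : Fin (d-1) → ℝ)).prod (convex_Ici c))
    (isClosed_singleton.prod isClosed_Ici) hdisj
  obtain ⟨p, hp⟩ := exists_dotR_eq d f
  have hu' : ∀ e ∈ E, ∀ b ∈ D, dotR d (e.1 - b.1, dotR d b q) p < u := fun e he b hb => by
    rw [← hp]; exact hu _ ⟨(e, b), ⟨he, hb⟩, rfl⟩
  have hv' : ∀ s, c ≤ s → v < s * p.2 := fun s hsc => by
    have := hv (0, s) ⟨rfl, hsc⟩
    simpa [hp, dotR] using this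
  have hu0 : 0 < u := by
    simpa [dotR] using hu' 0 hE0 0 hD0
  have hc0 : 0 < c := by
    simpa [dotR] using h 0 hE0 0 hD0 rfl
  have ht : 0 < p.2 := by
    have := hv' c le_rfl
    by_contra! hneg
    nlinarith
  refine ⟨(fun i => p.1 i / p.2, 0), rfl, fun e he b hb => ?_⟩
  have h1 := (hu' e he b hb).trans (huv.trans (hv' c le_rfl))
  have h2 : dotR d (e.1 - b.1, dotR d b q) p =
      (dotR d e (fun i => p.1 i / p.2, 0) +
        dotR d b (q - (fun i => p.1 i / p.2, 0))) * p.2 := by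
    rw [dotR_sub_right]
    generalize dotR d b q = s
    simp only [dotR, mul_zero, add_zero, add_mul, sub_mul, Finset.sum_mul, Pi.sub_apply,
      Finset.sum_sub_distrib]
    have h3 : ∀ x : Fin (d-1) → ℝ, ∑ i, x i * (p.1 i / p.2) * p.2 = ∑ i, x i * p.1 i :=
      fun x => Finset.sum_congr rfl fun i _ => by field_simp
    rw [h3, h3]; ring
  rw [h2] at h1
  exact lt_of_mul_lt_mul_right h1 ht.le

/-- the quasi-potential satisfies
`I(0,q) = inf_{γ ∈ ℝ^{d-1}×{0}} (I(0,γ) + I⁺(γ,q)) = sup_{a ∈ D̂} a·q`. -/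
theorem quasipotential_decomposition
    (d : ℕ) (hd : 2 ≤ d) (μ μ0 : Zd d → ℝ)
    (hμ : IsProb d μ) (hμ0 : IsProb d μ0)
    (hH0 : H0 d μ μ0) (hH1 : H1 d μ μ0) (hH2 : H2 d μ)
    (hH3 : H3 d μ μ0) (hH4 : H4 d μ μ0) :
    ∀ q : Rd d, q ≠ 0 → 0 ≤ q.2 →
      (⨅ γ : {γ : Rd d // γ.2 = 0},
        ((⨆ a : ↥(Dset d μ ∩ Dset d μ0), dotR d (a : Rd d) (γ : Rd d)) +
          ⨆ a : ↥(Dset d μ), dotR d (a : Rd d) (q - (γ : Rd d))))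
      = ⨆ a : ↥(Dhat d μ μ0), dotR d (a : Rd d) q := by
  intro q _ _
  have hs := fun a => (hH4 a).1
  have hs0 := fun a => (hH4 a).2
  have hDcomp : IsCompact (Dset d μ) := isCompact_jgf_le d μ hμ.1 hs hH2.1 1
  have hEcomp : IsCompact (Dset d μ ∩ Dset d μ0) :=
    hDcomp.inter_right ((lowerSemicontinuous_jgf d μ0 hμ0.1 hs0).isClosed_preimage 1)
  have hDconv : Convex ℝ (Dset d μ) := by
    simpa [Dset] using (convexOn_jgf d μ hμ.1 hs).convex_le 1
  have hD0conv : Convex ℝ (Dset d μ0) := by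
    simpa [Dset] using (convexOn_jgf d μ0 hμ0.1 hs0).convex_le 1
  have hD0 : (0 : Rd d) ∈ Dset d μ := (jgf_zero d μ hμ.2).le
  have hE0 : (0 : Rd d) ∈ Dset d μ ∩ Dset d μ0 := ⟨hD0, (jgf_zero d μ0 hμ0.2).le⟩
  have hDhat : ∀ a, a ∈ Dhat d μ μ0 ↔
      (∃ β : ℝ, (a.1, β) ∈ Dset d μ ∩ Dset d μ0) ∧ a ∈ Dset d μ := fun a =>
    and_congr_left' (mem_Theta_iff d μ μ0 hμ.1 hμ0.1 hs hs0 hH2.1 a.1)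
  have hDhat0 : (0 : Rd d) ∈ Dhat d μ μ0 := (hDhat 0).2 ⟨⟨0, hE0⟩, hD0⟩
  have : Nonempty (Dhat d μ μ0) := ⟨⟨0, hDhat0⟩⟩
  have : Nonempty (Dset d μ) := ⟨⟨0, hD0⟩⟩
  have : Nonempty ↥(Dset d μ ∩ Dset d μ0) := ⟨⟨0, hE0⟩⟩
  have : Nonempty {γ : Rd d // γ.2 = 0} := ⟨⟨0, rfl⟩⟩
  have hweak : ∀ γ : {γ : Rd d // γ.2 = 0}, (⨆ a : ↥(Dhat d μ μ0), dotR d (a : Rd d) q) ≤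
      (⨆ a : ↥(Dset d μ ∩ Dset d μ0), dotR d (a : Rd d) (γ : Rd d)) +
        ⨆ a : ↥(Dset d μ), dotR d (a : Rd d) (q - (γ : Rd d)) := by
    rintro ⟨γ, hγ⟩
    refine ciSup_le fun ⟨a, ha⟩ => ?_
    obtain ⟨⟨β, hβ⟩, haD⟩ := (hDhat a).1 ha
    have h1 := le_ciSup (bddAbove_range_dotR d hEcomp γ) ⟨_, hβ⟩
    have h2 := le_ciSup (bddAbove_range_dotR d hDcomp (q - γ)) ⟨a, haD⟩
    have h3 : dotR d a q = dotR d (a.1, β) γ + dotR d a (q - γ) := by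
      rw [dotR_sub_right]
      simp [dotR, hγ]
    rw [h3]
    exact add_le_add h1 h2
  refine le_antisymm (le_of_forall_gt fun c hc => ?_) (le_ciInf hweak)
  obtain ⟨c', hc', hcc'⟩ := exists_between hc
  have hbdd : BddAbove (Set.range fun a : Dhat d μ μ0 => dotR d (a : Rd d) q) := by
    refine (bddAbove_range_dotR d hDcomp q).mono ?_
    rintro _ ⟨a, rfl⟩
    exact ⟨⟨a, ((hDhat a).1 a.2).2⟩, rfl⟩
  obtain ⟨γ, hγ, hlt⟩ := exists_horizontal_dotR_add_lt d hEcomp hDcomp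
    (hDconv.inter hD0conv) hDconv hE0 hD0 q c' fun e he b hb heb =>
      (le_ciSup hbdd ⟨b, (hDhat b).2 ⟨⟨e.2, heb ▸ he⟩, hb⟩⟩).trans_lt hc'
  refine lt_of_le_of_lt ?_ hcc'
  refine (ciInf_le ⟨_, Set.forall_mem_range.2 hweak⟩ ⟨γ, hγ⟩).trans ?_
  exact ciSup_add_ciSup_le fun e b => (hlt e e.2 b b.2).le

end ReflectedRW
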